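/- arXiv:2104.14745 — 2 statements merged into one kernel-verified Lean document; each statement's English description precedes it below -/
import Mathlib

section
/- Let d > 4 be an odd prime power. If strength-3 difference schemes D₃(4d², 4d², 2) and D₃(12d², 12d², 2) exist, then for every m with 4 ≤ m ≤ d and every integer n with either 2d² + 4 ≤ n ≤ 4d² or n ≥ 4d² + 4, there exist a positive integer r and an irredundant mixed orthogonal array IrMOA(r, m+n, d^m2^n, 3). -/
open Finset

/-- The Hamming distance between two rows of an array: the number of columns
in which the rows differ. -/
def hamDist {ι κ : Type*} [Fintype κ] (A : ι → κ → ℕ) (i i' : ι) : ℕ :=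
  (Finset.univ.filter fun j => A i j ≠ A i' j).card

/-- `MD(A)`: the minimum Hamming distance over all pairs of distinct rows. -/
noncomputable def minDist {ι κ : Type*} [Fintype κ] (A : ι → κ → ℕ) : ℕ :=
  sInf {n | ∃ i i', i ≠ i' ∧ hamDist A i i' = n}

/-- `A` is a mixed orthogonal array of strength `k` (rows indexed by `ι`,
columns by `κ`, column `j` taking values in `{0, …, lv j − 1}`): in the
subarray given by any choice of at most `k` columns, every tuple of symbols
occurs equally often as a row, namely (number of rows)/(product of the levels
of the chosen columns) times. -/
def IsMOA {ι κ : Type*} [Fintype ι] [Fintype κ] [DecidableEq κ]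
    (A : ι → κ → ℕ) (lv : κ → ℕ) (k : ℕ) : Prop :=
  (∀ i j, A i j < lv j) ∧
  ∀ S : Finset κ, S.card ≤ k → ∀ x : κ → ℕ, (∀ j ∈ S, x j < lv j) →
    (Finset.univ.filter fun i : ι => ∀ j ∈ S, A i j = x j).card * ∏ j ∈ S, lv j
      = Fintype.card ι

/-- An irredundant mixed orthogonal array of strength `k`: an MOA of strength
`k` any two distinct rows of which have Hamming distance at least `k+1`. -/
def IsIrMOA {ι κ : Type*} [Fintype ι] [Fintype κ] [DecidableEq κ]
    (A : ι → κ → ℕ) (lv : κ → ℕ) (k : ℕ) : Prop :=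
  IsMOA A lv k ∧ ∀ i i' : ι, i ≠ i' → k + 1 ≤ hamDist A i i'

/-- A difference scheme `D(r, c, d)`: an `r × c` matrix over `ℤ_d` such that
for any two distinct columns the `r` differences of corresponding entries
take each value of `ℤ_d` exactly `r/d` times. -/
def IsDiffScheme {r c d : ℕ} (B : Fin r → Fin c → ZMod d) : Prop :=
  ∀ j j' : Fin c, j ≠ j' → ∀ g : ZMod d,
    (Finset.univ.filter fun i : Fin r => B i j - B i j' = g).card * d = r

/-- A difference scheme of strength 3, `D₃(r, c, d)`: an `r × c` matrix `B`
over `ℤ_d` whose developed array `B ⊕ (d)` (rows indexed by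
`(i, g) ∈ Fin r × ℤ_d`, with `(i,g)`-row `j`-entry `B i j + g`) is an
orthogonal array `OA(rd, c, d, 3)`. -/
def IsDiffScheme3 {r c d : ℕ} [NeZero d] (B : Fin r → Fin c → ZMod d) : Prop :=
  IsMOA (fun p : Fin r × ZMod d => fun j : Fin c => (B p.1 j + p.2).val)
    (fun _ : Fin c => d) 3

/-! ### Strength of linear arrays -/

/-- Dual vectors for pairs of columns make restriction to at most three columns surjective. -/
lemma exists_interp {G κ R : Type*} [CommRing R] [AddCommGroup G] [Module R G]
    [DecidableEq κ] [Nontrivial κ] (ev : G →ₗ[R] (κ → R))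
    (h : ∀ j a b, j ≠ a → j ≠ b → ∃ u, ev u j = 1 ∧ ev u a = 0 ∧ ev u b = 0)
    (S : Finset κ) (hS : S.card ≤ 3) (x : κ → R) : ∃ u, ∀ j ∈ S, ev u j = x j := by
  have key : ∀ j ∈ S, ∃ u, ev u j = 1 ∧ ∀ k ∈ S, k ≠ j → ev u k = 0 := by
    intro j hj
    have hc : (S.erase j).card ≤ 2 := by rw [Finset.card_erase_of_mem hj]; omega
    have : ∃ a b, j ≠ a ∧ j ≠ b ∧ S.erase j ⊆ {a, b} := by
      rcases Nat.lt_or_ge (S.erase j).card 1 with h0 | h0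
      · obtain ⟨a, ha⟩ := exists_ne j
        refine ⟨a, a, ha.symm, ha.symm, ?_⟩
        have : S.erase j = ∅ := by rw [← Finset.card_eq_zero]; omega
        simp [this]
      · rcases Nat.lt_or_ge (S.erase j).card 2 with h1 | h1
        · obtain ⟨a, ha⟩ := Finset.card_eq_one.mp (show (S.erase j).card = 1 by omega)
          have hm : a ∈ S.erase j := by simp [ha]
          have hne := (Finset.mem_erase.mp hm).1
          exact ⟨a, a, hne.symm, hne.symm, by simp [ha]⟩
        · obtain ⟨a, b, -, hab⟩ := Finset.card_eq_two.mp (show (S.erase j).card = 2 by omega)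
          have hm : a ∈ S.erase j := by simp [hab]
          have hm' : b ∈ S.erase j := by simp [hab]
          exact ⟨a, b, (Finset.mem_erase.mp hm).1.symm, (Finset.mem_erase.mp hm').1.symm, hab.le⟩
    obtain ⟨a, b, ha, hb, hsub⟩ := this
    obtain ⟨u, h1, h2, h3⟩ := h j a b ha hb
    refine ⟨u, h1, fun k hk hkj => ?_⟩
    have := hsub (Finset.mem_erase.mpr ⟨hkj, hk⟩)
    rcases Finset.mem_insert.mp this with rfl | h'
    · exact h2
    · rw [Finset.mem_singleton] at h'; subst h'; exact h3
  choose! u hu1 hu2 using key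
  refine ⟨∑ k ∈ S, x k • u k, fun j hj => ?_⟩
  rw [map_sum, Finset.sum_apply, Finset.sum_eq_single j]
  · simp [hu1 j hj]
  · intro k hk hkj
    simp [hu2 k hk j hj hkj.symm]
  · intro h; exact absurd hj h

lemma strength_count {G κ R : Type*} [CommRing R] [Fintype R] [DecidableEq R]
    [AddCommGroup G] [Fintype G] [Module R G]
    [DecidableEq κ] [Nontrivial κ] (ev : G →ₗ[R] (κ → R))
    (h : ∀ j a b, j ≠ a → j ≠ b → ∃ u, ev u j = 1 ∧ ev u a = 0 ∧ ev u b = 0)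
    (S : Finset κ) (hS : S.card ≤ 3) (x : κ → R) :
    (Finset.univ.filter fun u : G => ∀ j ∈ S, ev u j = x j).card * Fintype.card R ^ S.card
      = Fintype.card G := by
  classical
  have hcount : ∀ y : S → R, (Finset.univ.filter fun u : G => (fun j : S => ev u j) = y).card
      = (Finset.univ.filter fun u : G => ∀ j ∈ S, ev u j = x j).card := by
    intro y
    obtain ⟨v, hv⟩ := exists_interp ev h S hS
      (fun j => if hj : j ∈ S then y ⟨j, hj⟩ - x j else 0)
    refine Finset.card_bij' (fun u _ => u - v) (fun u _ => u + v) ?_ ?_ ?_ ?_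
    · intro u hu
      simp only [Finset.mem_filter, Finset.mem_univ, true_and] at hu ⊢
      intro j hj
      have := congrFun hu ⟨j, hj⟩
      simp only at this
      simp [hv j hj, hj, this]
    · intro u hu
      simp only [Finset.mem_filter, Finset.mem_univ, true_and] at hu ⊢
      funext j
      simp [hv j j.2, hu j j.2]
    · intro u _; simp
    · intro u _; simp
  have := Finset.card_eq_sum_card_fiberwise (s := (Finset.univ : Finset G))
    (t := (Finset.univ : Finset (S → R))) (f := fun u => fun j : S => ev u j) (by simp)
  rw [Finset.sum_congr rfl (fun y _ => hcount y)] at this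
  simp only [Finset.sum_const, Finset.card_univ, Fintype.card_fun, Fintype.card_coe,
    smul_eq_mul] at this
  rw [this, mul_comm]

/-! ### The quadratic Reed-Solomon array -/

/-- Evaluation of `c₀ + c₁ X + c₂ X²` at the points `pt j`. -/
def rsEval {F κ : Type*} [Field F] (pt : κ → F) : (F × F × F) →ₗ[F] (κ → F) where
  toFun c := fun j => c.1 + c.2.1 * pt j + c.2.2 * pt j ^ 2
  map_add' c c' := by funext j; simp; ring
  map_smul' r c := by funext j; simp; ring

lemma rsEval_apply {F κ : Type*} [Field F] (pt : κ → F) (c : F × F × F) (j : κ) :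
    rsEval pt c j = c.1 + c.2.1 * pt j + c.2.2 * pt j ^ 2 := rfl

lemma rs_dual {F κ : Type*} [Field F] (pt : κ → F) (hpt : Function.Injective pt)
    (j a b : κ) (ha : j ≠ a) (hb : j ≠ b) :
    ∃ u, rsEval pt u j = 1 ∧ rsEval pt u a = 0 ∧ rsEval pt u b = 0 := by
  have h1 : pt j - pt a ≠ 0 := sub_ne_zero.mpr (hpt.ne ha)
  have h2 : pt j - pt b ≠ 0 := sub_ne_zero.mpr (hpt.ne hb)
  set k := ((pt j - pt a) * (pt j - pt b))⁻¹ with hk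
  have hk1 : k * ((pt j - pt a) * (pt j - pt b)) = 1 := inv_mul_cancel₀ (mul_ne_zero h1 h2)
  refine ⟨(k * (pt a * pt b), -k * (pt a + pt b), k), ?_, ?_, ?_⟩
  · rw [rsEval_apply]; linear_combination hk1
  · rw [rsEval_apply]; ring
  · rw [rsEval_apply]; ring

lemma rs_dist {F κ : Type*} [Field F] [DecidableEq F] [Fintype κ] (pt : κ → F)
    (hpt : Function.Injective pt) (hκ : 4 ≤ Fintype.card κ) (c c' : F × F × F)
    (hc : c.2 ≠ c'.2) :
    2 ≤ (Finset.univ.filter fun j => rsEval pt c j ≠ rsEval pt c' j).card := by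
  by_contra hlt
  have hsum := Finset.card_filter_add_card_filter_not (s := (Finset.univ : Finset κ))
    (fun j => rsEval pt c j = rsEval pt c' j)
  rw [Finset.card_univ] at hsum
  have : 2 < (Finset.univ.filter fun j => rsEval pt c j = rsEval pt c' j).card := by
    simp only [ne_eq] at hlt
    omega
  obtain ⟨i, hi, j, hj, k, hk, hij, hik, hjk⟩ := Finset.two_lt_card.mp this
  simp only [Finset.mem_filter, Finset.mem_univ, true_and] at hi hj hk
  rw [rsEval_apply, rsEval_apply] at hi hj hk
  have hij' : pt i - pt j ≠ 0 := sub_ne_zero.mpr (hpt.ne hij)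
  have hik' : pt i - pt k ≠ 0 := sub_ne_zero.mpr (hpt.ne hik)
  have hjk' : pt j - pt k ≠ 0 := sub_ne_zero.mpr (hpt.ne hjk)
  have e1 : (c.2.1 - c'.2.1) + (c.2.2 - c'.2.2) * (pt i + pt j) = 0 := by
    apply mul_left_cancel₀ hij'; linear_combination hi - hj
  have e2 : (c.2.1 - c'.2.1) + (c.2.2 - c'.2.2) * (pt i + pt k) = 0 := by
    apply mul_left_cancel₀ hik'; linear_combination hi - hk
  have e3 : c.2.2 - c'.2.2 = 0 := by
    apply mul_left_cancel₀ hjk'; linear_combination e1 - e2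
  have e4 : c.2.1 - c'.2.1 = 0 := by
    rw [e3] at e1; simpa using e1
  exact hc (Prod.ext (sub_eq_zero.mp e4) (sub_eq_zero.mp e3))

/-! ### The binary linear array -/

/-- The index space of linear functionals on `ℤ₂³`. -/
abbrev Zt := ZMod 2 × ZMod 2 × ZMod 2

/-- Evaluation of a functional at eight points of `ℤ₂³`, the first four being
affinely independent. -/
def fz (z : Zt) : Fin 8 → ZMod 2 :=
  ![0, z.1, z.2.1, z.2.2, z.1 + z.2.1, z.1 + z.2.2, z.2.1 + z.2.2, z.1 + z.2.1 + z.2.2]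

lemma fz_add : ∀ (z z' : Zt) (y : Fin 8), fz (z + z') y = fz z y + fz z' y := by decide

lemma fz_smul : ∀ (r : ZMod 2) (z : Zt) (y : Fin 8), fz (r • z) y = r * fz z y := by decide

lemma fz_zero : ∀ y : Fin 8, fz 0 y = 0 := by decide

lemma fz_dual : ∀ y a b : Fin 8, y ≠ a → y ≠ b →
    ∃ (c : ZMod 2) (z : Zt), c + fz z y = 1 ∧ c + fz z a = 0 ∧ c + fz z b = 0 := by decide

lemma fz_nonconst : ∀ (z : Zt) (c : ZMod 2), z ≠ 0 →
    ∃ y : Fin 4, c + fz z (y.castLE (by decide)) ≠ 0 := by decide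

/-- The binary linear array with columns `(blk j, lev j)`. -/
def binEval {κ P : Type*} (blk : κ → P) (lev : κ → Fin 8) :
    ((P → ZMod 2) × Zt) →ₗ[ZMod 2] (κ → ZMod 2) where
  toFun u := fun j => u.1 (blk j) + fz u.2 (lev j)
  map_add' u u' := by funext j; simp [fz_add]; ring
  map_smul' r u := by funext j; simp only [Prod.smul_fst, Prod.smul_snd, Pi.smul_apply, fz_smul, RingHom.id_apply, smul_eq_mul]; ring

lemma binEval_apply {κ P : Type*} (blk : κ → P) (lev : κ → Fin 8)
    (u : (P → ZMod 2) × Zt) (j : κ) :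
    binEval blk lev u j = u.1 (blk j) + fz u.2 (lev j) := rfl

lemma bin_dual {κ P : Type*} [DecidableEq P] (blk : κ → P) (lev : κ → Fin 8)
    (hinj : ∀ j k, blk j = blk k → lev j = lev k → j = k)
    (j a b : κ) (ha : j ≠ a) (hb : j ≠ b) :
    ∃ u, binEval blk lev u j = 1 ∧ binEval blk lev u a = 0 ∧ binEval blk lev u b = 0 := by
  have char2 : ∀ x : ZMod 2, x + x = 0 := by decide
  by_cases h1 : blk a = blk j <;> by_cases h2 : blk b = blk j
  · obtain ⟨c, z, e1, e2, e3⟩ := fz_dual (lev j) (lev a) (lev b)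
      (fun e => ha (hinj _ _ h1.symm e)) (fun e => hb (hinj _ _ h2.symm e))
    exact ⟨(fun _ => c, z), e1, e2, e3⟩
  · obtain ⟨c, z, e1, e2, -⟩ := fz_dual (lev j) (lev a) (lev a)
      (fun e => ha (hinj _ _ h1.symm e)) (fun e => ha (hinj _ _ h1.symm e))
    refine ⟨(fun i => if i = blk j then c else fz z (lev b), z), ?_, ?_, ?_⟩ <;>
      simp [binEval_apply, h1, h2, e1, e2, char2]
  · obtain ⟨c, z, e1, e2, -⟩ := fz_dual (lev j) (lev b) (lev b)
      (fun e => hb (hinj _ _ h2.symm e)) (fun e => hb (hinj _ _ h2.symm e))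
    refine ⟨(fun i => if i = blk j then c else fz z (lev a), z), ?_, ?_, ?_⟩ <;>
      simp [binEval_apply, h1, h2, e1, e2, char2]
  · refine ⟨(fun i => if i = blk j then 1 else 0, 0), ?_, ?_, ?_⟩ <;>
      simp [binEval_apply, h1, h2, fz_zero]

/-- The translation word attached to `t`: supported on the first two levels. -/
def shiftWord {κ P : Type*} (blk : κ → P) (lev : κ → Fin 8) (t : P → ZMod 2) : κ → ZMod 2 :=
  fun j => if lev j ≤ 1 then t (blk j) else 0

lemma le_card_filter_of_inj {κ : Type*} [Fintype κ] (q : κ → Prop) [DecidablePred q] (k : ℕ)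
    (f : Fin k → κ) (hf : Function.Injective f) (hq : ∀ i, q (f i)) :
    k ≤ (Finset.univ.filter q).card := by
  have := Finset.card_le_card_of_injOn (s := (Finset.univ : Finset (Fin k)))
    (t := Finset.univ.filter q) f (by intro i _; simp [hq]) (hf.injOn)
  simpa using this

/-- Distance bounds for words of the binary code, shifted by a word `t`. -/
lemma bin_dist_four {κ P : Type*} [Fintype κ] (blk : κ → P) (lev : κ → Fin 8)
    (col : P → Fin 4 → κ) (hblk : ∀ i y, blk (col i y) = i)
    (hlev : ∀ i y, lev (col i y) = y.castLE (by decide))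
    (f : Fin 4 → P) (hf : Function.Injective f)
    (u : (P → ZMod 2) × Zt) (hu : u ≠ 0) :
    4 ≤ (Finset.univ.filter fun j => binEval blk lev u j ≠ 0).card := by
  by_cases hz : u.2 = 0
  · have hw : u.1 ≠ 0 := fun h => hu (Prod.ext h hz)
    obtain ⟨i, hi⟩ := Function.ne_iff.mp hw
    refine le_card_filter_of_inj _ 4 (col i) ?_ ?_
    · intro y y' h
      have := congrArg lev h
      rw [hlev, hlev] at this
      exact Fin.castLE_injective _ this
    · intro y
      rw [binEval_apply, hblk, hz, fz_zero, add_zero]; exact hi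
  · choose y hy using fun c => fz_nonconst u.2 c hz
    refine le_card_filter_of_inj _ 4 (fun k => col (f k) (y (u.1 (f k)))) ?_ ?_
    · intro k k' h
      have := congrArg blk h
      simp only [hblk] at this
      exact hf this
    · intro k
      rw [binEval_apply, hblk, hlev]; exact hy _

lemma bin_dist_two {κ P : Type*} [Fintype κ] (blk : κ → P) (lev : κ → Fin 8)
    (col : P → Fin 4 → κ) (hblk : ∀ i y, blk (col i y) = i)
    (hlev : ∀ i y, lev (col i y) = y.castLE (by decide))
    (f : Fin 2 → P) (hf : Function.Injective f)
    (u : (P → ZMod 2) × Zt) (t : P → ZMod 2) (ht : t ≠ 0) (htf : ∀ k, t (f k) = 0) :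
    2 ≤ (Finset.univ.filter fun j => binEval blk lev u j + shiftWord blk lev t j ≠ 0).card := by
  by_cases hz : u.2 = 0
  · obtain ⟨i, hi⟩ := Function.ne_iff.mp ht
    have hcol : Function.Injective (col i) := by
      intro y y' h
      have := congrArg lev h
      rw [hlev, hlev] at this
      exact Fin.castLE_injective _ this
    have hi1 : t i = 1 := by
      have : ∀ x : ZMod 2, x ≠ 0 → x = 1 := by decide
      exact this _ hi
    by_cases hw : u.1 i = 0
    · refine le_card_filter_of_inj _ 2 (fun k => col i (![0, 1] k)) (hcol.comp (by decide)) ?_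
      intro k
      have : ((![0, 1] k : Fin 4).castLE (by decide) : Fin 8) ≤ 1 := by revert k; decide
      rw [binEval_apply, shiftWord, hblk, hlev, if_pos this, hz, fz_zero, hw, hi1]
      decide
    · refine le_card_filter_of_inj _ 2 (fun k => col i (![2, 3] k)) (hcol.comp (by decide)) ?_
      intro k
      have : ¬ ((![2, 3] k : Fin 4).castLE (by decide) : Fin 8) ≤ 1 := by revert k; decide
      rw [binEval_apply, shiftWord, hblk, hlev, if_neg this, hz, fz_zero, add_zero, add_zero]
      exact hw
  · choose y hy using fun c => fz_nonconst u.2 c hz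
    refine le_card_filter_of_inj _ 2 (fun k => col (f k) (y (u.1 (f k)))) ?_ ?_
    · intro k k' h
      have := congrArg blk h
      simp only [hblk] at this
      exact hf this
    · intro k
      rw [binEval_apply, shiftWord, hblk, hlev, htf, ite_self, add_zero]; exact hy _

/-! ### The combined array -/

lemma exists_shift (F : Type*) [Fintype F] (p : ℕ) (hp : 2 * Fintype.card F + 2 ≤ p) :
    ∃ T : F × F → Fin p → ZMod 2, Function.Injective T ∧ ∀ g i, i.val < 2 → T g i = 0 := by
  have hc : Fintype.card (F × F) ≤ Fintype.card (Fin (p - 2) → ZMod 2) := by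
    rw [Fintype.card_prod, Fintype.card_fun, Fintype.card_fin, ZMod.card]
    have h1 : Fintype.card F ≤ 2 ^ Fintype.card F := Nat.lt_two_pow_self.le
    calc _ ≤ 2 ^ Fintype.card F * 2 ^ Fintype.card F := Nat.mul_le_mul h1 h1
      _ = 2 ^ (2 * Fintype.card F) := by rw [← pow_add, two_mul]
      _ ≤ 2 ^ (p - 2) := Nat.pow_le_pow_right (by norm_num) (by omega)
  obtain ⟨E⟩ := Function.Embedding.nonempty_of_card_le hc
  refine ⟨fun g i => if h : 2 ≤ i.val then E g ⟨i.val - 2, by omega⟩ else 0, ?_, ?_⟩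
  · intro g g' h
    apply E.injective
    funext k
    have := congrFun h ⟨k.val + 2, by omega⟩
    simpa using this
  · intro g i hi
    simp [Nat.not_le.mpr hi]

/-- The columns of the binary part: `j` lies in block `j % p` on level `j / p`, `p = n / 4`. -/
lemma exists_cols (n p : ℕ) (hp : p = n / 4) (hp4 : 4 ≤ p) :
    ∃ (blk : Fin n → Fin p) (lev : Fin n → Fin 8) (col : Fin p → Fin 4 → Fin n),
      (∀ j k, blk j = blk k → lev j = lev k → j = k) ∧
      (∀ i y, blk (col i y) = i) ∧
      (∀ i y, lev (col i y) = y.castLE (by decide)) := by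
  have hpos : 0 < p := by omega
  refine ⟨fun j => ⟨j.val % p, Nat.mod_lt _ hpos⟩,
    fun j => ⟨j.val / p, by rw [Nat.div_lt_iff_lt_mul hpos]; omega⟩,
    fun i y => ⟨i.val + p * y.val, ?_⟩, ?_, ?_, ?_⟩
  · have h1 := i.isLt
    have h2 : p * y.val ≤ p * 3 := Nat.mul_le_mul_left _ (by omega)
    omega
  · intro j k h1 h2
    simp only [Fin.mk.injEq] at h1 h2
    apply Fin.ext
    rw [← Nat.mod_add_div j.val p, ← Nat.mod_add_div k.val p, h1, h2]
  · intro i y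
    apply Fin.ext
    simp [Nat.add_mul_mod_self_left, Nat.mod_eq_of_lt i.isLt]
  · intro i y
    apply Fin.ext
    simp [Nat.add_mul_div_left _ _ hpos, Nat.div_eq_of_lt i.isLt]

lemma main_aux {F : Type} [Field F] [Fintype F] [DecidableEq F] {d : ℕ}
    (hF : Fintype.card F = d) (m n : ℕ) (hm4 : 4 ≤ m) (hmd : m ≤ d) (hn : 8 * d + 8 ≤ n) :
    ∃ (ι : Type) (_ : Fintype ι) (_ : Nonempty ι) (C : ι → (Fin m ⊕ Fin n) → ℕ),
      IsIrMOA C (Sum.elim (fun _ => d) fun _ => 2) 3 := by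
  obtain ⟨p, hp⟩ : ∃ p, p = n / 4 := ⟨_, rfl⟩
  have hp4 : 4 ≤ p := by omega
  obtain ⟨blk, lev, col, hinj, hblk, hlev⟩ := exists_cols n p hp hp4
  obtain ⟨T, hT, hT0⟩ := exists_shift F p (by omega)
  have hcard : Fintype.card (Fin m) ≤ Fintype.card F := by simpa [hF] using hmd
  obtain ⟨pt⟩ := Function.Embedding.nonempty_of_card_le hcard
  let e : F ≃ Fin d := Fintype.equivFinOfCardEq hF
  have : Nontrivial (Fin m) := Fin.nontrivial_iff_two_le.mpr (by omega)
  have : Nontrivial (Fin n) := Fin.nontrivial_iff_two_le.mpr (by omega)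
  let sh : F × F × F → Fin n → ZMod 2 := fun c => shiftWord blk lev (T c.2)
  let C : (F × F × F) × ((Fin p → ZMod 2) × Zt) → (Fin m ⊕ Fin n) → ℕ := fun r =>
    Sum.elim (fun j => (e (rsEval pt r.1 j) : ℕ))
      (fun j => (binEval blk lev r.2 j + sh r.1 j).val)
  refine ⟨_, inferInstance, inferInstance, C, ⟨?_, ?_⟩, ?_⟩
  · rintro r (j | j)
    · exact (e _).isLt
    · exact ZMod.val_lt (binEval blk lev r.2 j + sh r.1 j)
  · intro S hS x hx
    have hSc : S.toLeft.card + S.toRight.card = S.card := Finset.card_toLeft_add_card_toRight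
    have hdpos : 0 < d := by omega
    -- symbols as field elements
    let xl : Fin m → F := fun j => if h : x (Sum.inl j) < d then e.symm ⟨x (Sum.inl j), h⟩ else 0
    let xr : Fin n → ZMod 2 := fun j => (x (Sum.inr j) : ZMod 2)
    have hA := strength_count (rsEval pt) (rs_dual pt pt.injective) S.toLeft (by omega) xl
    have hB := fun c : F × F × F => strength_count (binEval blk lev) (bin_dual blk lev hinj)
      S.toRight (by omega) (fun j => xr j - sh c j)
    have hiff : ∀ r, (∀ j ∈ S, C r j = x j) ↔ (∀ j ∈ S.toLeft, rsEval pt r.1 j = xl j) ∧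
        (∀ j ∈ S.toRight, binEval blk lev r.2 j = xr j - sh r.1 j) := by
      intro r
      have hl : ∀ j ∈ S.toLeft, (C r (Sum.inl j) = x (Sum.inl j) ↔ rsEval pt r.1 j = xl j) := by
        intro j hj
        have hlt : x (Sum.inl j) < d := hx _ (Finset.mem_toLeft.mp hj)
        simp only [C, xl, Sum.elim_inl, dif_pos hlt, Equiv.eq_symm_apply, Fin.ext_iff]
      have hr : ∀ j ∈ S.toRight, (C r (Sum.inr j) = x (Sum.inr j) ↔
          binEval blk lev r.2 j = xr j - sh r.1 j) := by
        intro j hj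
        have hlt : x (Sum.inr j) < 2 := hx _ (Finset.mem_toRight.mp hj)
        simp only [C, xr, Sum.elim_inr, eq_sub_iff_add_eq]
        constructor
        · intro h; rw [← h, ZMod.natCast_zmod_val]
        · intro h; rw [h, ZMod.val_natCast, Nat.mod_eq_of_lt hlt]
      constructor
      · intro h
        exact ⟨fun j hj => (hl j hj).mp (h _ (Finset.mem_toLeft.mp hj)),
          fun j hj => (hr j hj).mp (h _ (Finset.mem_toRight.mp hj))⟩
      · rintro ⟨h1, h2⟩ (j | j) hj
        · exact (hl j (Finset.mem_toLeft.mpr hj)).mpr (h1 j (Finset.mem_toLeft.mpr hj))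
        · exact (hr j (Finset.mem_toRight.mpr hj)).mpr (h2 j (Finset.mem_toRight.mpr hj))
    have hprod : ∏ j ∈ S, Sum.elim (fun _ : Fin m => d) (fun _ : Fin n => 2) j
        = d ^ S.toLeft.card * 2 ^ S.toRight.card := by
      conv_lhs => rw [← Finset.toLeft_disjSum_toRight (u := S)]
      rw [Finset.prod_disjSum]
      simp
    have hcnt : (Finset.univ.filter fun r => ∀ j ∈ S, C r j = x j).card * 2 ^ S.toRight.card
        = (Finset.univ.filter fun c => ∀ j ∈ S.toLeft, rsEval pt c j = xl j).card
          * Fintype.card ((Fin p → ZMod 2) × Zt) := by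
      rw [Finset.filter_congr (fun r _ => hiff r), Finset.card_filter, Fintype.sum_prod_type,
        Finset.sum_mul, Finset.card_filter, Finset.sum_mul]
      refine Finset.sum_congr rfl fun c _ => ?_
      by_cases hc : ∀ j ∈ S.toLeft, rsEval pt c j = xl j
      · have := hB c
        rw [ZMod.card, Finset.card_filter] at this
        simp only [eq_true hc, true_and, if_true, one_mul]
        convert this
      · simp only [hc, false_and, if_false, Finset.sum_const_zero, zero_mul]
    rw [hprod, Fintype.card_prod, ← hA, hF]
    calc _ = ((Finset.univ.filter fun r => ∀ j ∈ S, C r j = x j).card * 2 ^ S.toRight.card)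
          * d ^ S.toLeft.card := by ring
      _ = ((Finset.univ.filter fun c => ∀ j ∈ S.toLeft, rsEval pt c j = xl j).card
          * d ^ S.toLeft.card) * Fintype.card ((Fin p → ZMod 2) × Zt) := by rw [hcnt]; ring
      _ = _ := by congr!
  · intro r r' hrr
    have hham : hamDist C r r'
        = (Finset.univ.filter fun j => rsEval pt r.1 j ≠ rsEval pt r'.1 j).card
        + (Finset.univ.filter fun j => binEval blk lev (r.2 - r'.2) j
            + (sh r.1 j - sh r'.1 j) ≠ 0).card := by
      unfold hamDist
      rw [Finset.card_filter, Fintype.sum_sum_type, Finset.card_filter, Finset.card_filter]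
      congr 1
      · refine Finset.sum_congr rfl fun j _ => ?_
        simp only [C, Sum.elim_inl, ne_eq, Fin.val_inj, EmbeddingLike.apply_eq_iff_eq]
      · refine Finset.sum_congr rfl fun j _ => ?_
        have : (C r (Sum.inr j) ≠ C r' (Sum.inr j)) ↔ (binEval blk lev (r.2 - r'.2) j
            + (sh r.1 j - sh r'.1 j) ≠ 0) := by
          simp only [C, Sum.elim_inr, ne_eq, (ZMod.val_injective 2).eq_iff]
          rw [← sub_eq_zero, map_sub, Pi.sub_apply, add_sub_add_comm]
        simp only [this]
    rw [hham]
    by_cases hg : r.1.2 = r'.1.2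
    · by_cases h0 : r.1.1 = r'.1.1
      · have h1 : r.1 = r'.1 := Prod.ext h0 hg
        have h2 : r.2 - r'.2 ≠ 0 := fun h => hrr (Prod.ext h1 (sub_eq_zero.mp h))
        have := bin_dist_four blk lev col hblk hlev (Fin.castLE hp4) (Fin.castLE_injective hp4)
          _ h2
        simp only [h1, sub_self, add_zero]
        omega
      · have : (Finset.univ.filter fun j => rsEval pt r.1 j ≠ rsEval pt r'.1 j)
            = Finset.univ := by
          rw [Finset.filter_eq_self]
          intro j _ h
          rw [rsEval_apply, rsEval_apply, hg] at h
          exact h0 (by linear_combination h)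
        rw [this, Finset.card_univ, Fintype.card_fin]
        omega
    · have h1 := rs_dist pt pt.injective (by simpa using hm4) r.1 r'.1 hg
      have h2 := bin_dist_two blk lev col hblk hlev (Fin.castLE (show 2 ≤ p by omega))
        (Fin.castLE_injective _) (r.2 - r'.2) (T r.1.2 - T r'.1.2)
        (sub_ne_zero.mpr (hT.ne hg)) (fun k => by
          rw [Pi.sub_apply, hT0 _ _ k.isLt, hT0 _ _ k.isLt, sub_zero])
      have h3 : ∀ j, sh r.1 j - sh r'.1 j = shiftWord blk lev (T r.1.2 - T r'.1.2) j := by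
        intro j
        simp only [sh, shiftWord]
        split_ifs <;> simp
      simp only [h3]
      omega

/-- Let `d > 4` be an odd prime power. If strength-3
difference schemes `D₃(4d², 4d², 2)` and `D₃(12d², 12d², 2)` exist, then for
every `4 ≤ m ≤ d` and every `n` with `2d² + 4 ≤ n ≤ 4d²` or `n ≥ 4d² + 4`,
there exist `r > 0` and an `IrMOA(r, m+n, d^m2^n, 3)`. -/
theorem statement10 {d : ℕ} (hd4 : 4 < d) (hodd : Odd d) (hpp : IsPrimePow d)
    (D₁ : Fin (4 * d ^ 2) → Fin (4 * d ^ 2) → ZMod 2) (hD₁ : IsDiffScheme3 D₁)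
    (D₂ : Fin (12 * d ^ 2) → Fin (12 * d ^ 2) → ZMod 2) (hD₂ : IsDiffScheme3 D₂)
    (m n : ℕ) (hm4 : 4 ≤ m) (hmd : m ≤ d)
    (hn : (2 * d ^ 2 + 4 ≤ n ∧ n ≤ 4 * d ^ 2) ∨ 4 * d ^ 2 + 4 ≤ n) :
    ∃ (r : ℕ) (C : Fin r → (Fin m ⊕ Fin n) → ℕ),
      0 < r ∧ IsIrMOA C (Sum.elim (fun _ => d) fun _ => 2) 3 := by
  have hn' : 8 * d + 8 ≤ n := by
    have : 2 * d ^ 2 + 4 ≤ n := by omega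
    nlinarith
  have : Nonempty (Field (Fin d)) := by
    rw [Fintype.nonempty_field_iff, Fintype.card_fin]; exact hpp
  obtain ⟨fld⟩ := this
  obtain ⟨ι, _, _, C, hC⟩ := @main_aux (Fin d) fld _ _ d (Fintype.card_fin d) m n hm4 hmd hn'
  let e := Fintype.equivFin ι
  refine ⟨Fintype.card ι, fun i => C (e.symm i), Fintype.card_pos, ⟨?_, ?_⟩, ?_⟩
  · intro i j; exact hC.1.1 _ _
  · intro S hS x hx
    refine Eq.trans ?_ ((hC.1.2 S hS x hx).trans (Fintype.card_fin _).symm)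
    congr 1
    refine Finset.card_bij (fun i _ => e.symm i) ?_ ?_ ?_
    · intro i hi; simpa using hi
    · intro i _ i' _ h; exact e.symm.injective h
    · intro i hi; exact ⟨e i, by simpa using hi, by simp⟩
  · intro i i' h
    exact hC.2 _ _ (e.symm.injective.ne h)
end

section
/- Let k ≥ 1 and t ≥ 1. Let d_{11},…,d_{m₁1} be m₁ pairwise distinct prime powers with d_{u1} ≥ 2k − 1 for every u, and set d = d_{11}d_{21}⋯d_{m₁1}. For each w = 2,…,t let d = d_{1w}d_{2w}⋯d_{m_w w} be a factorization of d into positive integers. Then for all nonnegative integers n₁,…,n_t with 1 ≤ n₁+⋯+n_t ≤ 2k there exists an irredundant mixed orthogonal array of strength k with d^k rows, having 2k − (n₁+⋯+n_t) columns of d levels and, for each w = 1,…,t and each i = 1,…,m_w, exactly n_w columns of d_{iw} levels, i.e. an IrMOA(d^k, d^{2k−(n₁+⋯+n_t)}d_{11}^{n₁}⋯d_{m₁1}^{n₁}⋯d_{1t}^{n_t}⋯d_{m_t t}^{n_t}, k). -/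
open Finset

/-- MDS-type code with `d^k` words over an alphabet of size `d`. -/
def HasCode (B : Type) (d k : ℕ) : Prop :=
  ∃ G : Fin (d ^ k) → B → Fin d, ∀ T : Finset B, T.card = k →
    ∀ r r', (∀ j ∈ T, G r j = G r' j) → r = r'

lemma hasCode_of {B R X : Type} [Fintype R] [Fintype X] (d k : ℕ)
    (hR : Fintype.card R = d ^ k) (hX : Fintype.card X = d)
    (G : R → B → X)
    (h : ∀ T : Finset B, T.card = k → ∀ r r', (∀ j ∈ T, G r j = G r' j) → r = r') :
    HasCode B d k := by
  let e := Fintype.equivFinOfCardEq hR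
  let f := Fintype.equivFinOfCardEq hX
  refine ⟨fun r j => f (G (e.symm r) j), fun T hT r r' hr => ?_⟩
  apply e.symm.injective
  exact h T hT _ _ fun j hj => f.injective (hr j hj)

lemma hasCode_field {B F : Type} [Fintype B] [Field F] [Fintype F] (k : ℕ)
    (hB : Fintype.card B ≤ Fintype.card F + 1) :
    HasCode B (Fintype.card F) k := by
  classical
  obtain ⟨e⟩ : Nonempty (B ↪ Option F) := by
    apply Function.Embedding.nonempty_of_card_le
    simpa using hB
  let v : Option F → F := fun o => o.elim 1 id
  let w : Option F → F := fun o => o.elim 0 (fun _ => 1)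
  have hvw : ∀ o o', o ≠ o' → v o' * w o - v o * w o' ≠ 0 := by
    intro o o' h
    rcases o with _ | a <;> rcases o' with _ | b <;> simp [v, w] at h ⊢
    exact fun h' => h (sub_eq_zero.1 h').symm
  refine hasCode_of (R := Fin k → F) (X := F) _ k (by simp) rfl
    (fun c b => ∑ i : Fin k, v (e b) ^ (i : ℕ) * w (e b) ^ (i.rev : ℕ) * c i) ?_
  intro T hT r r' h
  let g := T.equivFinOfCardEq hT
  let M : Matrix (Fin k) (Fin k) F :=
    Matrix.projVandermonde (fun i => v (e (g.symm i))) (fun i => w (e (g.symm i)))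
  have hM : M.det ≠ 0 := by
    rw [Matrix.det_projVandermonde]
    refine Finset.prod_ne_zero_iff.2 fun i _ => Finset.prod_ne_zero_iff.2 fun j hj => ?_
    apply hvw
    intro h'
    have := g.symm.injective (Subtype.ext (e.injective h'))
    simp [this] at hj
  have hinj : Function.Injective M.mulVec :=
    Matrix.mulVec_injective_of_isUnit ((Matrix.isUnit_iff_isUnit_det _).2 hM.isUnit)
  apply hinj
  funext i
  have := h (g.symm i) (g.symm i).2
  simpa [M, Matrix.mulVec, dotProduct, Matrix.projVandermonde_apply] using this

lemma hasCode_primePow {B : Type} [Fintype B] (q k : ℕ) (hq : IsPrimePow q)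
    (hB : Fintype.card B ≤ q + 1) : HasCode B q k := by
  obtain ⟨p, a, hp, ha, rfl⟩ := hq
  have : Fact p.Prime := ⟨hp.nat_prime⟩
  have := Fintype.ofFinite (GaloisField p a)
  have hc : Fintype.card (GaloisField p a) = p ^ a := by
    rw [← Nat.card_eq_fintype_card]; exact GaloisField.card p a ha.ne'
  have := hasCode_field (B := B) (F := GaloisField p a) k (by rw [hc]; exact hB)
  rwa [hc] at this

lemma hasCode_prod {B : Type} (m k : ℕ) (q : Fin m → ℕ) (h : ∀ i, HasCode B (q i) k) :
    HasCode B (∏ i, q i) k := by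
  choose G hG using h
  refine hasCode_of (R := ∀ i, Fin (q i ^ k)) (X := ∀ i, Fin (q i)) _ k
    (by simp [Finset.prod_pow]) (by simp) (fun r b i => G i (r i) b) ?_
  intro T hT r r' hr
  funext i
  exact hG i T hT _ _ fun j hj => congrFun (hr j hj) i

lemma count_lemma {ι κ : Type} [Fintype ι] [Fintype κ] [DecidableEq κ] (lv : κ → ℕ)
    (U S : Finset κ) (hSU : S ⊆ U) (A : ι → (j : κ) → Fin (lv j))
    (hbij : Function.Bijective (fun (r : ι) (j : U) => A r j))
    (x : κ → ℕ) (hx : ∀ j ∈ S, x j < lv j) :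
    (Finset.univ.filter fun i : ι => ∀ j ∈ S, (A i j : ℕ) = x j).card * ∏ j ∈ S, lv j
      = Fintype.card ι := by
  classical
  let s : (j : U) → Finset (Fin (lv j)) := fun j => Finset.univ.filter fun y =>
    (j : κ) ∈ S → (y : ℕ) = x j
  have h1 : (Finset.univ.filter fun i : ι => ∀ j ∈ S, (A i j : ℕ) = x j).card
      = (Fintype.piFinset s).card := by
    refine Finset.card_bij (fun r _ => fun j : U => A r j) ?_ ?_ ?_
    · intro r hr
      simp only [Finset.mem_filter, Finset.mem_univ, true_and] at hr
      simp only [s, Fintype.mem_piFinset, Finset.mem_filter, Finset.mem_univ, true_and]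
      exact fun j hj => hr j hj
    · intro r _ r' _ h
      exact hbij.1 h
    · intro f hf
      obtain ⟨r, hr⟩ := hbij.2 f
      refine ⟨r, ?_, hr⟩
      simp only [s, Fintype.mem_piFinset, Finset.mem_filter, Finset.mem_univ, true_and] at hf ⊢
      intro j hj
      have := hf ⟨j, hSU hj⟩ hj
      rw [← hr] at this
      exact this
  have h2 : ∀ j : U, (s j).card = if (j : κ) ∈ S then 1 else lv j := by
    intro j
    split_ifs with hj
    · rw [Finset.card_eq_one]
      refine ⟨⟨x j, hx j hj⟩, ?_⟩
      ext y
      simp [s, hj, Fin.ext_iff]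
    · simp [s, hj]
  have h3 : Fintype.card ι = ∏ j ∈ U, lv j := by
    rw [Fintype.card_of_bijective hbij, Fintype.card_pi]
    simp only [Fintype.card_fin]
    exact Finset.prod_coe_sort U lv
  rw [h1, Fintype.card_piFinset, Finset.prod_congr rfl (fun j _ => h2 j), h3,
    Finset.prod_coe_sort U (fun j => if j ∈ S then 1 else lv j)]
  rw [← Finset.prod_sdiff hSU, ← Finset.prod_sdiff hSU]
  congr 1
  rw [Finset.prod_congr rfl (g := fun _ => 1) (s₁ := S) (fun j hj => by simp [hj])]
  rw [Finset.prod_const_one, mul_one]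
  exact Finset.prod_congr rfl fun j hj => by simp [(Finset.mem_sdiff.1 hj).2]

lemma expand {B κ : Type} [Fintype B] [DecidableEq B] [Fintype κ] [DecidableEq κ]
    (k d : ℕ) (hB : Fintype.card B = 2 * k) (hc : HasCode B d k) (π : κ → B) (lv : κ → ℕ)
    (hπ : ∀ b, ∏ j : {j // π j = b}, lv j = d) :
    ∃ C : Fin (d ^ k) → κ → ℕ, IsIrMOA C lv k := by
  classical
  obtain ⟨G, hG⟩ := hc
  have hφ : ∀ b, Nonempty (Fin d ≃ ((j : {j // π j = b}) → Fin (lv j))) := by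
    intro b
    refine ⟨Fintype.equivOfCardEq ?_⟩
    simp [hπ b]
  let φ := fun b => Classical.choice (hφ b)
  let A : Fin (d ^ k) → (j : κ) → Fin (lv j) := fun r j => φ (π j) (G r (π j)) ⟨j, rfl⟩
  have hA : ∀ r r' b, (∀ j, π j = b → A r j = A r' j) → G r b = G r' b := by
    intro r r' b h
    apply (φ b).injective
    funext ⟨j, hj⟩
    subst hj
    exact h j rfl
  refine ⟨fun r j => A r j, ⟨fun i j => (A i j).2, ?_⟩, ?_⟩
  · intro S hS x hx
    obtain ⟨T, hST, hT⟩ : ∃ T : Finset B, S.image π ⊆ T ∧ T.card = k :=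
      Finset.exists_superset_card_eq (Finset.card_image_le.trans hS) (by omega)
    let U : Finset κ := Finset.univ.filter fun j => π j ∈ T
    refine count_lemma lv U S ?_ A ?_ x hx
    · intro j hj
      simp only [U, Finset.mem_filter, Finset.mem_univ, true_and]
      exact hST (Finset.mem_image_of_mem _ hj)
    · rw [Fintype.bijective_iff_injective_and_card]
      constructor
      · intro r r' h
        apply hG T hT
        intro b hb
        apply hA
        intro j hj
        exact congrFun h ⟨j, by simp [U, hj, hb]⟩
      · rw [Fintype.card_pi]
        simp only [Fintype.card_fin]
        rw [Finset.prod_coe_sort U lv,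
          ← Finset.prod_fiberwise_of_maps_to (s := U) (t := T) (g := π)
            (fun j hj => (Finset.mem_filter.1 hj).2)]
        rw [Finset.prod_congr rfl (g := fun _ => d), Finset.prod_const, hT]
        intro b hb
        rw [← hπ b, ← Finset.prod_subtype]
        intro j
        simp only [U, Finset.mem_filter, Finset.mem_univ, true_and]
        exact ⟨fun h => h.2, fun h => ⟨h ▸ hb, h⟩⟩
  · intro r r' hr
    have h1 : (Finset.univ.filter fun b => G r b = G r' b).card < k := by
      by_contra! h
      obtain ⟨T, hT, hTk⟩ := Finset.exists_subset_card_eq h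
      exact hr (hG T hTk r r' fun j hj => (Finset.mem_filter.1 (hT hj)).2)
    have h2 := Finset.card_filter_add_card_filter_not (s := (Finset.univ : Finset B))
      (fun b => G r b = G r' b)
    rw [Finset.card_univ, hB] at h2
    have h3 : (Finset.univ.filter fun b => ¬ G r b = G r' b) ⊆
        (Finset.univ.filter fun j => (A r j : ℕ) ≠ A r' j).image π := by
      intro b hb
      have hb' := (Finset.mem_filter.1 hb).2
      by_contra hcon
      apply hb'
      apply hA
      intro j hj
      by_contra hne
      apply hcon
      refine Finset.mem_image.2 ⟨j, ?_, hj⟩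
      simp only [Finset.mem_filter, Finset.mem_univ, true_and]
      exact fun h => hne (Fin.ext h)
    have h4 := (Finset.card_le_card h3).trans Finset.card_image_le
    have h5 : hamDist (fun r j => (A r j : ℕ)) r r' =
      (Finset.univ.filter fun j => (A r j : ℕ) ≠ A r' j).card := by
      unfold hamDist; congr
    rw [h5]
    omega

/-- Let `k ≥ 1`, `t ≥ 1`. Let `dd 0 1, …, dd 0 (m 0)` be
pairwise distinct prime powers, each `≥ 2k − 1`, with product `d`, and for each
`w` let `dd w 1 ⋯ dd w (m w) = d` be a factorization of `d`. Then for all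
`n₁,…,n_t ≥ 0` with `1 ≤ n₁+⋯+n_t ≤ 2k` there is an irredundant MOA of
strength `k` with `d^k` rows, `2k − (n₁+⋯+n_t)` columns of `d` levels and,
for each `w, i`, exactly `n w` columns of `dd w i` levels. -/
theorem statement15 (k t : ℕ) (hk : 1 ≤ k) (ht : 1 ≤ t)
    (m : Fin t → ℕ) (dd : (w : Fin t) → Fin (m w) → ℕ) (d : ℕ)
    (hfac : ∀ w, ∏ i, dd w i = d)
    (hpp : ∀ i, IsPrimePow (dd ⟨0, ht⟩ i))
    (hdist : Function.Injective (dd ⟨0, ht⟩))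
    (hge : ∀ i, 2 * k - 1 ≤ dd ⟨0, ht⟩ i)
    (n : Fin t → ℕ) (hn1 : 1 ≤ ∑ w, n w) (hn2k : ∑ w, n w ≤ 2 * k) :
    ∃ C : Fin (d ^ k) →
        (Fin (2 * k - ∑ w, n w) ⊕ (Σ w : Fin t, Fin (n w) × Fin (m w))) → ℕ,
      IsIrMOA C (Sum.elim (fun _ => d) fun p => dd p.1 p.2.2) k := by
  let B := Fin (2 * k - ∑ w, n w) ⊕ (Σ w : Fin t, Fin (n w))
  have hB : Fintype.card B = 2 * k := by
    simp only [B, Fintype.card_sum, Fintype.card_sigma, Fintype.card_fin]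
    omega
  have hc : HasCode B d k := by
    rw [← hfac ⟨0, ht⟩]
    refine hasCode_prod _ k _ fun i => hasCode_primePow _ k (hpp i) ?_
    have := hge i
    omega
  refine expand k d hB hc (Sum.map id fun p => ⟨p.1, p.2.1⟩) _ ?_
  rintro (b | ⟨w, a⟩)
  · let x : {j : Fin (2 * k - ∑ w, n w) ⊕ (Σ w : Fin t, Fin (n w) × Fin (m w)) //
        (Sum.map id (fun p => ⟨p.1, p.2.1⟩) j : B) = Sum.inl b} := ⟨Sum.inl b, rfl⟩
    rw [Fintype.prod_eq_single x]
    · rfl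
    · rintro ⟨j | j, hj⟩ hne
      · simp at hj
        subst hj
        exact absurd rfl hne
      · simp at hj
  · rw [← hfac w]
    symm
    refine Fintype.prod_bijective (fun i => ⟨Sum.inr ⟨w, a, i⟩, rfl⟩) ⟨?_, ?_⟩ _ _ ?_
    · intro i i' h
      have h' := congrArg Subtype.val h
      simpa using h'
    · rintro ⟨j | ⟨w', a', i⟩, hj⟩
      · simp at hj
      · simp only [Sum.map_inr, Sum.inr.injEq, Sigma.mk.injEq] at hj
        obtain ⟨rfl, hj⟩ := hj
        exact ⟨i, rfl⟩
    · intro i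
      rfl
end
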